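/- arXiv:math/0612730 — 3 statements merged into one kernel-verified Lean document; each statement's English description precedes it below -/
import Mathlib

section
/- If f is a symmetric Laurent polynomial (f[z] = f[z^{-1}]), then (D f)[z] = (D_sym f)[z], where D := T_1 T_0 + q^{-1}abcd·T_0^{-1}T_1^{-1} is built from the DAHA operators and D_sym is the Askey–Wilson second order q-difference operator. -/
open scoped BigOperators

noncomputable section

/-- The field of rational functions over ℂ, in which Laurent polynomials live. -/
local notation "F" => RatFunc ℂ

/-- Scalar constants in `F`. -/
def Cc (x : ℂ) : F := RatFunc.C x

/-- The variable `z`. -/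
def Xv : F := RatFunc.X

/-- Substitution `z ↦ t` in a rational function (well defined since the
substitution points used here are transcendental over ℂ). -/
def subst (t : F) (f : F) : F := RatFunc.eval (RatFunc.C) t f

/-- `f` is a Laurent polynomial in `z`. -/
def IsLaurent (f : F) : Prop :=
  ∃ (p : Polynomial ℂ) (n : ℕ), f = algebraMap (Polynomial ℂ) F p / Xv ^ n

/-- The DAHA operator `T₁` of the basic representation. -/
def T1op (a b : ℂ) (f : F) : F :=
  ((Cc a + Cc b) * Xv - (1 + Cc a * Cc b)) / (1 - Xv ^ 2) * f
    + ((1 - Cc a * Xv) * (1 - Cc b * Xv)) / (1 - Xv ^ 2) * subst Xv⁻¹ f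

/-- The DAHA operator `T₀` of the basic representation. -/
def T0op (q c d : ℂ) (f : F) : F :=
  (Cc q)⁻¹ * Xv * ((Cc c * Cc d + Cc q) * Xv - (Cc c + Cc d) * Cc q) / (Cc q - Xv ^ 2) * f
    - ((Cc c - Xv) * (Cc d - Xv)) / (Cc q - Xv ^ 2) * subst (Cc q * Xv⁻¹) f

/-- The inverse of `T₁`: `T₁⁻¹ = -(ab)⁻¹T₁ - (1 + (ab)⁻¹)`. -/
def T1inv (a b : ℂ) (f : F) : F :=
  -(Cc a * Cc b)⁻¹ * T1op a b f - (1 + (Cc a * Cc b)⁻¹) * f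

/-- The inverse of `T₀`: `T₀⁻¹ = -q(cd)⁻¹T₀ - (1 + q(cd)⁻¹)`. -/
def T0inv (q c d : ℂ) (f : F) : F :=
  -(Cc q * (Cc c * Cc d)⁻¹) * T0op q c d f - (1 + Cc q * (Cc c * Cc d)⁻¹) * f

/-- `Y = T₁T₀`. -/
def Yop (q a b c d : ℂ) (f : F) : F := T1op a b (T0op q c d f)

/-- `Y⁻¹ = T₀⁻¹T₁⁻¹`. -/
def Yinv (q a b c d : ℂ) (f : F) : F := T0inv q c d (T1inv a b f)

/-- `D = Y + q⁻¹abcd·Y⁻¹`. -/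
def Dop (q a b c d : ℂ) (f : F) : F :=
  Yop q a b c d f + Cc (q⁻¹ * (a * b * c * d)) * Yinv q a b c d f

/-- The Askey–Wilson second order q-difference operator `D_sym`. -/
def DsymOp (q a b c d : ℂ) (f : F) : F :=
  ((1 - Cc a * Xv) * (1 - Cc b * Xv) * (1 - Cc c * Xv) * (1 - Cc d * Xv)) /
      ((1 - Xv ^ 2) * (1 - Cc q * Xv ^ 2)) * (subst (Cc q * Xv) f - f)
    + ((Cc a - Xv) * (Cc b - Xv) * (Cc c - Xv) * (Cc d - Xv)) /
      ((1 - Xv ^ 2) * (Cc q - Xv ^ 2)) * (subst ((Cc q)⁻¹ * Xv) f - f)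
    + (1 + (Cc q)⁻¹ * Cc a * Cc b * Cc c * Cc d) * f

/-- q-Pochhammer symbol `(x;q)_k`. -/
def qPoch (x q : ℂ) (k : ℕ) : ℂ := ∏ j ∈ Finset.range k, (1 - x * q ^ j)

/-- The monic Askey–Wilson Laurent polynomial `P_n[z;a,b,c,d|q]`. -/
def AWP (q a b c d : ℂ) (n : ℕ) : F :=
  Cc (a⁻¹ ^ n) * ∑ k ∈ Finset.range (n + 1),
    Cc (qPoch (q⁻¹ ^ n) q k * qPoch (a * b * q ^ k) q (n - k) * qPoch (a * c * q ^ k) q (n - k)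
        * qPoch (a * d * q ^ k) q (n - k) * q ^ k
        / (qPoch q q k * qPoch (a * b * c * d * q ^ (n + k) / q) q (n - k)))
      * (∏ j ∈ Finset.range k, (1 - Cc a * Xv * Cc (q ^ j)))
      * (∏ j ∈ Finset.range k, (1 - Cc a * Xv⁻¹ * Cc (q ^ j)))

/-- `Q_n[z] := (ab)⁻¹ z⁻¹ (1-az)(1-bz) P_{n-1}[z;qa,qb,c,d|q]`. -/
def Qpoly (q a b c d : ℂ) (n : ℕ) : F :=
  (Cc (a * b))⁻¹ * Xv⁻¹ * (1 - Cc a * Xv) * (1 - Cc b * Xv) *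
    AWP q (q * a) (q * b) c d (n - 1)

/-- Elementary symmetric polynomials in a,b,c,d. -/
def esym1 (a b c d : ℂ) : ℂ := a + b + c + d
def esym2 (a b c d : ℂ) : ℂ := a*b + a*c + b*c + a*d + b*d + c*d
def esym3 (a b c d : ℂ) : ℂ := a*b*c + a*b*d + a*c*d + b*c*d
def esym4 (a b c d : ℂ) : ℂ := a*b*c*d


lemma aux_transc_of {t : RatFunc ℂ} (g : RatFunc ℂ)
    (h : IsAlgebraic ℂ t → IsAlgebraic ℂ g) (hg : Transcendental ℂ g) : Transcendental ℂ t :=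
  fun ht => hg (h ht)

lemma aux_alg_C (x : ℂ) : IsAlgebraic ℂ (Cc x) := by
  have : Cc x = algebraMap ℂ (RatFunc ℂ) x := by simp [Cc, RatFunc.algebraMap_eq_C]
  rw [this]
  exact isAlgebraic_algebraMap x

lemma aux_X : Transcendental ℂ Xv := RatFunc.transcendental_X

lemma aux_Xinv : Transcendental ℂ Xv⁻¹ := by
  refine aux_transc_of Xv (fun h => ?_) aux_X
  simpa using h.inv

lemma aux_qXinv {q : ℂ} (hq : q ≠ 0) : Transcendental ℂ (Cc q * Xv⁻¹) := by
  refine aux_transc_of Xv⁻¹ (fun h => ?_) aux_Xinv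
  have h2 := (aux_alg_C q).inv.mul h
  have hC : Cc q ≠ 0 := by simpa [Cc] using hq
  rwa [inv_mul_cancel_left₀ hC] at h2

lemma aux_Xsq (x y : ℂ) (hy : y ≠ 0) : Cc x - Cc y * Xv ^ 2 ≠ 0 := by
  intro h
  have hC : Cc y ≠ 0 := by simpa [Cc] using hy
  have h1 : Xv ^ 2 = (Cc y)⁻¹ * Cc x := by
    field_simp
    linear_combination -h
  have h2 : IsAlgebraic ℂ (Xv ^ 2) := by
    rw [h1]
    exact (aux_alg_C y).inv.mul (aux_alg_C x)
  exact aux_X (h2.of_pow (by norm_num))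

lemma aux_hom {t : RatFunc ℂ} (ht : Transcendental ℂ t) :
    ∃ φ : RatFunc ℂ →+* RatFunc ℂ, ∀ f, subst t f = φ f := by
  have hinj : Function.Injective (Polynomial.eval₂RingHom (RatFunc.C : ℂ →+* RatFunc ℂ) t) :=
    transcendental_iff_injective.1 ht
  refine ⟨RatFunc.liftRingHom (Polynomial.eval₂RingHom RatFunc.C t)
    (nonZeroDivisors_le_comap_nonZeroDivisors_of_injective _ hinj), fun f => ?_⟩
  rw [RatFunc.liftRingHom_apply]
  rfl

lemma aux_comp (φ : RatFunc ℂ →+* RatFunc ℂ) (hφ : ∀ x, φ (Cc x) = Cc x) (t f : RatFunc ℂ) :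
    φ (subst t f) = subst (φ t) f := by
  have : φ.comp RatFunc.C = RatFunc.C := RingHom.ext hφ
  simp only [subst, RatFunc.eval, map_div₀, Polynomial.hom_eval₂, this]

theorem stmt9 (q a b c d : ℂ) (hq : q ≠ 0) (hroot : ∀ m : ℕ, 1 ≤ m → q ^ m ≠ 1)
    (ha : a ≠ 0) (hb : b ≠ 0) (hc : c ≠ 0) (hd : d ≠ 0)
    (habcd : ∀ m : ℕ, a * b * c * d ≠ q⁻¹ ^ m) :
    ∀ f : RatFunc ℂ, IsLaurent f → subst Xv⁻¹ f = f →
      Dop q a b c d f = DsymOp q a b c d f := by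
  intro f _ hf
  obtain ⟨s, hs⟩ := aux_hom aux_Xinv
  obtain ⟨r, hr⟩ := aux_hom (aux_qXinv hq)
  have hsC : ∀ x, s (Cc x) = Cc x := fun x => by rw [← hs]; simp [subst, Cc]
  have hrC : ∀ x, r (Cc x) = Cc x := fun x => by rw [← hr]; simp [subst, Cc]
  have hsX : s Xv = Xv⁻¹ := by rw [← hs]; simp [subst, Xv]
  have hrX : r Xv = Cc q * Xv⁻¹ := by rw [← hr]; simp [subst, Xv]
  have hX : Xv ≠ 0 := RatFunc.X_ne_zero
  have hC : ∀ x : ℂ, x ≠ 0 → Cc x ≠ 0 := fun x hx => by simpa [Cc] using hx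
  have hq' := hC q hq
  have ha' := hC a ha
  have hb' := hC b hb
  have hc' := hC c hc
  have hd' := hC d hd
  have h1 : Cc 1 = 1 := by simp [Cc]
  have n1 : 1 - Xv ^ 2 ≠ 0 := by simpa [h1] using aux_Xsq 1 1 one_ne_zero
  have n2 : Cc q - Xv ^ 2 ≠ 0 := by simpa [h1] using aux_Xsq q 1 one_ne_zero
  have n3 : 1 - Cc q * Xv ^ 2 ≠ 0 := by simpa [h1] using aux_Xsq 1 q hq
  have e1 : r f = subst ((Cc q)⁻¹ * Xv) f := by
    conv_lhs => rw [← hf]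
    rw [aux_comp r hrC, map_inv₀, hrX]
    congr 1
    simp [mul_comm]
  have e2 : s (r f) = subst (Cc q * Xv) f := by
    rw [← hr, aux_comp s hsC, map_mul, map_inv₀, hsX, hsC, inv_inv]
  have hT1 : T1inv a b f = -(Cc a * Cc b)⁻¹ * f := by
    unfold T1inv T1op
    rw [hf]
    field_simp
    ring
  have hsf : s f = f := by rw [← hs, hf]
  have hCp : Cc (q⁻¹ * (a * b * c * d)) = (Cc q)⁻¹ * (Cc a * Cc b * Cc c * Cc d) := by
    simp [Cc]
  unfold Dop Yop Yinv DsymOp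
  rw [hT1, hCp, ← e1, ← e2]
  unfold T0inv T1op T0op
  simp only [hs, hr, map_sub, map_mul, map_div₀, map_add, map_inv₀, map_pow, map_one, map_neg,
    hsC, hrC, hsX, hrX, hsf]
  generalize s (r f) = u
  generalize r f = v
  generalize Cc q = Q at *
  generalize Cc a = A at *
  generalize Cc b = B at *
  generalize Cc c = C at *
  generalize Cc d = D at *
  generalize Xv = z at *
  have n4 : Q - z⁻¹ ^ 2 ≠ 0 := by
    intro h
    apply n3
    field_simp at h
    linear_combination -h
  have n4' : Q - z⁻¹ ^ 2 = -(1 - Q * z ^ 2) / z ^ 2 := by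
    field_simp
    ring
  have n3' : 1 - z ^ 2 * Q ≠ 0 := by rwa [mul_comm]
  rw [n4']
  field_simp
  ring


end
end

section
/- The operators K_0 := D_sym and K_1 := multiplication by z + z^{-1}, acting on symmetric Laurent polynomials, satisfy the AW(3) relation (q + q^{-1})K_0 K_1 K_0 − K_0² K_1 − K_1 K_0² = B·K_0 + C_1·K_1 + D_1, with B = (1 − q^{-1})²(e_3 + q·e_1), C_1 = q^{-1}(q − q^{-1})²·e_4, D_1 = −q^{-3}(1−q)²(1+q)(e_1e_4 + q·e_3). -/
open scoped BigOperators

noncomputable section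

/-- The field of rational functions over ℂ, in which Laurent polynomials live. -/
local notation "F" => RatFunc ℂ

/-- numerator of `A(z)` -/
def hP {K : Type*} [Field K] (a b c d z : K) : K :=
  (1 - a * z) * (1 - b * z) * (1 - c * z) * (1 - d * z)

/-- numerator of `A(1/z)` -/
def hR {K : Type*} [Field K] (a b c d z : K) : K :=
  (a - z) * (b - z) * (c - z) * (d - z)

def hA {K : Type*} [Field K] (q a b c d z : K) : K :=
  hP a b c d z / ((1 - z ^ 2) * (1 - q * z ^ 2))

def hB {K : Type*} [Field K] (q a b c d z : K) : K :=
  hR a b c d z / ((1 - z ^ 2) * (q - z ^ 2))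

def hG {K : Type*} [Field K] (q a b c d z : K) : K :=
  1 + q⁻¹ * a * b * c * d - hA q a b c d z - hB q a b c d z

def hx {K : Type*} [Field K] (z : K) : K := z + z⁻¹

theorem hP_eq {K : Type*} [Field K] (a b c d z e1 e2 e3 e4 : K)
    (h1 : e1 = a + b + c + d) (h2 : e2 = a*b + a*c + b*c + a*d + b*d + c*d)
    (h3 : e3 = a*b*c + a*b*d + a*c*d + b*c*d) (h4 : e4 = a*b*c*d) :
    hP a b c d z = 1 - e1 * z + e2 * z ^ 2 - e3 * z ^ 3 + e4 * z ^ 4 := by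
  subst h1 h2 h3 h4; unfold hP; ring

theorem hR_eq {K : Type*} [Field K] (a b c d z e1 e2 e3 e4 : K)
    (h1 : e1 = a + b + c + d) (h2 : e2 = a*b + a*c + b*c + a*d + b*d + c*d)
    (h3 : e3 = a*b*c + a*b*d + a*c*d + b*c*d) (h4 : e4 = a*b*c*d) :
    hR a b c d z = e4 - e3 * z + e2 * z ^ 2 - e1 * z ^ 3 + z ^ 4 := by
  subst h1 h2 h3 h4; unfold hR; ring

theorem hG_eq {K : Type*} [Field K] (q a b c d z e1 e2 e3 e4 : K)
    (h1 : e1 = a + b + c + d) (h2 : e2 = a*b + a*c + b*c + a*d + b*d + c*d)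
    (h3 : e3 = a*b*c + a*b*d + a*c*d + b*c*d) (h4 : e4 = a*b*c*d)
    (hq : q ≠ 0) (n1 : 1 - z ^ 2 ≠ 0) (n2 : 1 - q * z ^ 2 ≠ 0) (n3 : q - z ^ 2 ≠ 0) :
    hG q a b c d z = z * ((1 + z ^ 2) * (q * e1 + e3)
      - z * ((1 + q) * (q + e2 + e4 / q))) / ((1 - q * z ^ 2) * (q - z ^ 2)) := by
  have : q⁻¹ * a * b * c * d = q⁻¹ * e4 := by rw [h4]; ring
  unfold hG hA hB
  rw [hP_eq a b c d z e1 e2 e3 e4 h1 h2 h3 h4, hR_eq a b c d z e1 e2 e3 e4 h1 h2 h3 h4, this]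
  field_simp
  ring

theorem hplus {K : Type*} [Field K] (q a b c d z : K) (hq : q ≠ 0) (hz : z ≠ 0)
    (n1 : 1 - z ^ 2 ≠ 0) (n2 : 1 - q * z ^ 2 ≠ 0) (n3 : q - z ^ 2 ≠ 0)
    (n4 : 1 - q ^ 2 * z ^ 2 ≠ 0) (n5 : 1 - q ^ 3 * z ^ 2 ≠ 0) :
    hG q a b c d (q * z) * ((q + q⁻¹) * hx (q * z) - hx (q * z) - hx z)
      + hG q a b c d z * ((q + q⁻¹) * hx z - hx (q * z) - hx z)
      = (1 - q⁻¹) ^ 2 * ((a*b*c + a*b*d + a*c*d + b*c*d) + q * (a + b + c + d)) := by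
  have m1 : 1 - (q * z) ^ 2 ≠ 0 := by rwa [mul_pow]
  have m2 : 1 - q * (q * z) ^ 2 = 1 - q ^ 3 * z ^ 2 := by ring
  have m3 : q - (q * z) ^ 2 = q * (1 - q * z ^ 2) := by ring
  rw [hG_eq q a b c d z _ _ _ _ rfl rfl rfl rfl hq n1 n2 n3,
    hG_eq q a b c d (q * z) _ _ _ _ rfl rfl rfl rfl hq m1 (m2 ▸ n5)
      (m3 ▸ mul_ne_zero hq n2), m2, m3]
  generalize a*b*c + a*b*d + a*c*d + b*c*d = e3
  generalize a + b + c + d = e1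
  generalize a*b + a*c + b*c + a*d + b*d + c*d = e2
  generalize a*b*c*d = e4
  unfold hx
  field_simp
  ring

set_option maxRecDepth 100000 in
set_option maxHeartbeats 4000000 in
theorem hzero {K : Type*} [Field K] (q a b c d z : K) (hq : q ≠ 0) (hz : z ≠ 0)
    (n1 : 1 - z ^ 2 ≠ 0) (n2 : 1 - q * z ^ 2 ≠ 0) (n3 : q - z ^ 2 ≠ 0)
    (n4 : 1 - q ^ 2 * z ^ 2 ≠ 0) (n5 : q ^ 2 - z ^ 2 ≠ 0) :
    hA q a b c d z * hB q a b c d (q * z) * ((q + q⁻¹) * hx (q * z) - 2 * hx z)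
      + hB q a b c d z * hA q a b c d (q⁻¹ * z) * ((q + q⁻¹) * hx (q⁻¹ * z) - 2 * hx z)
      + hG q a b c d z ^ 2 * hx z * (q + q⁻¹ - 2)
      = (1 - q⁻¹) ^ 2 * ((a*b*c + a*b*d + a*c*d + b*c*d) + q * (a + b + c + d))
          * hG q a b c d z
        + q⁻¹ * (q - q⁻¹) ^ 2 * (a*b*c*d) * hx z
        + -(q⁻¹ ^ 3) * (1 - q) ^ 2 * (1 + q) * ((a + b + c + d) * (a*b*c*d)
            + q * (a*b*c + a*b*d + a*c*d + b*c*d)) := by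
  rw [hG_eq q a b c d z _ _ _ _ rfl rfl rfl rfl hq n1 n2 n3]
  have k1 : hB q a b c d (q * z) * ((q + q⁻¹) * hx (q * z) - 2 * hx z)
      = hR a b c d (q * z) * (1 - q ^ 2) / (q ^ 3 * z * (1 - q * z ^ 2)) := by
    have m1 : 1 - (q * z) ^ 2 = 1 - q ^ 2 * z ^ 2 := by ring
    have m3 : q - (q * z) ^ 2 = q * (1 - q * z ^ 2) := by ring
    unfold hB hx
    rw [m1, m3]
    field_simp
    ring
  have k2 : hA q a b c d (q⁻¹ * z) * ((q + q⁻¹) * hx (q⁻¹ * z) - 2 * hx z)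
      = hP a b c d (q⁻¹ * z) * (q ^ 2 - 1) * q / (z * (q - z ^ 2)) := by
    have m1 : 1 - (q⁻¹ * z) ^ 2 = (q ^ 2 - z ^ 2) / q ^ 2 := by field_simp
    have m3 : 1 - q * (q⁻¹ * z) ^ 2 = (q - z ^ 2) / q := by field_simp
    unfold hA hx
    rw [m1, m3]
    field_simp
    ring
  rw [mul_assoc, k1, mul_assoc (hB q a b c d z), k2]
  unfold hA hB
  rw [hP_eq a b c d z _ _ _ _ rfl rfl rfl rfl, hR_eq a b c d z _ _ _ _ rfl rfl rfl rfl,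
    hP_eq a b c d (q⁻¹ * z) _ _ _ _ rfl rfl rfl rfl,
    hR_eq a b c d (q * z) _ _ _ _ rfl rfl rfl rfl]
  generalize a*b*c + a*b*d + a*c*d + b*c*d = e3
  generalize a + b + c + d = e1
  generalize a*b + a*c + b*c + a*d + b*d + c*d = e2
  generalize a*b*c*d = e4
  unfold hx
  obtain ⟨u, hu⟩ : ∃ u, u = 1 - z ^ 2 := ⟨_, rfl⟩
  obtain ⟨v, hv⟩ : ∃ v, v = 1 - q * z ^ 2 := ⟨_, rfl⟩
  obtain ⟨w, hw⟩ : ∃ w, w = q - z ^ 2 := ⟨_, rfl⟩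
  rw [← hu] at n1
  rw [← hv] at n2
  rw [← hw] at n3
  rw [← hu, ← hv, ← hw]
  field_simp
  rw [hu, hv, hw]
  ring

theorem hmain {K : Type*} [Field K] (σ τ : K →+* K) (hστ : ∀ f, σ (τ f) = f)
    (hτσ : ∀ f, τ (σ f) = f) (A B x κ s β C1 D1 Ap Bp Am Bm xp xm xpp xmm : K)
    (sA : σ A = Ap) (sB : σ B = Bp) (tA : τ A = Am) (tB : τ B = Bm)
    (sx : σ x = xp) (tx : τ x = xm) (sxp : σ xp = xpp) (txm : τ xm = xmm)
    (sκ : σ κ = κ) (tκ : τ κ = κ)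
    (hpp : s * xp - xpp - x = 0) (hmm : s * xm - xmm - x = 0)
    (hp : (κ - Ap - Bp) * (s * xp - xp - x) + (κ - A - B) * (s * x - xp - x) = β)
    (hm : (κ - A - B) * (s * x - x - xm) + (κ - Am - Bm) * (s * xm - x - xm) = β)
    (h0 : A * Bp * (s * xp - 2 * x) + B * Am * (s * xm - 2 * x)
      + (κ - A - B) ^ 2 * x * (s - 2) = β * (κ - A - B) + C1 * x + D1)
    (D : K → K) (hD : ∀ f, D f = A * (σ f - f) + B * (τ f - f) + κ * f) (f : K) :
    s * D (x * D f) - D (D (x * f)) - x * D (D f) = β * D f + C1 * (x * f) + D1 * f := by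
  have txp : τ xp = x := by rw [← sx, hτσ]
  have sxm : σ xm = x := by rw [← tx, hστ]
  simp only [hD, map_add, map_sub, map_mul, hστ, hτσ, sA, sB, tA, tB, sx, tx, sxp, txm, sκ, tκ,
    txp, sxm]
  linear_combination A * Ap * σ (σ f) * hpp + B * Bm * τ (τ f) * hmm + A * σ f * hp
    + B * τ f * hm + f * h0

theorem inj_scale (t : ℂ) (ht : t ≠ 0) : nonZeroDivisors (Polynomial ℂ) ≤
    (nonZeroDivisors (RatFunc ℂ)).comap
      (Polynomial.eval₂RingHom (RatFunc.C : ℂ →+* RatFunc ℂ) (RatFunc.C t * RatFunc.X)) := by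
  intro p hp
  have hp0 : p ≠ 0 := nonZeroDivisors.ne_zero hp
  simp only [Submonoid.mem_comap, Polynomial.coe_eval₂RingHom]
  apply mem_nonZeroDivisors_of_ne_zero
  have : Polynomial.eval₂ (RatFunc.C : ℂ →+* RatFunc ℂ) (RatFunc.C t * RatFunc.X) p
      = algebraMap (Polynomial ℂ) (RatFunc ℂ) (p.comp (Polynomial.C t * Polynomial.X)) := by
    rw [Polynomial.comp, Polynomial.hom_eval₂, RatFunc.algebraMap_comp_C, map_mul,
      RatFunc.algebraMap_C, RatFunc.algebraMap_X]
  rw [this]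
  intro h
  rw [map_eq_zero_iff _ (RatFunc.algebraMap_injective ℂ)] at h
  rw [Polynomial.comp_C_mul_X_eq_zero_iff (mem_nonZeroDivisors_of_ne_zero ht)] at h
  exact hp0 h

/-- the substitution `z ↦ t z` as a ring homomorphism -/
def scaleHom (t : ℂ) (ht : t ≠ 0) : RatFunc ℂ →+* RatFunc ℂ :=
  RatFunc.liftRingHom _ (inj_scale t ht)

theorem scaleHom_apply (t : ℂ) (ht : t ≠ 0) (f : RatFunc ℂ) :
    _root_.subst (Cc t * Xv) f = scaleHom t ht f := by
  rw [scaleHom, RatFunc.liftRingHom_apply]; rfl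

theorem scaleHom_C (t : ℂ) (ht : t ≠ 0) (c : ℂ) : scaleHom t ht (Cc c) = Cc c := by
  rw [← scaleHom_apply]; exact RatFunc.eval_C ..

theorem scaleHom_X (t : ℂ) (ht : t ≠ 0) : scaleHom t ht Xv = Cc t * Xv := by
  rw [← scaleHom_apply]; exact RatFunc.eval_X ..

theorem scaleHom_comp (s t : ℂ) (hs : s ≠ 0) (ht : t ≠ 0) (hst : t * s = 1) (f : RatFunc ℂ) :
    scaleHom s hs (scaleHom t ht f) = f := by
  have key : ∀ p : Polynomial ℂ, scaleHom s hs (scaleHom t ht (algebraMap _ _ p))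
      = algebraMap _ _ p := by
    intro p
    induction p using Polynomial.induction_on' with
    | add p r hp hr => simp only [map_add, hp, hr]
    | monomial n c =>
      rw [← Polynomial.C_mul_X_pow_eq_monomial]
      simp only [map_mul, map_pow, RatFunc.algebraMap_C, RatFunc.algebraMap_X]
      change scaleHom s hs (scaleHom t ht (Cc c)) * (scaleHom s hs (scaleHom t ht Xv)) ^ n
        = Cc c * Xv ^ n
      have : Cc t * Cc s = 1 := by
        unfold Cc; rw [← map_mul, hst, map_one]
      rw [scaleHom_C, scaleHom_C, scaleHom_X, map_mul, scaleHom_C, scaleHom_X, ← mul_assoc,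
        this, one_mul]
  rw [← RatFunc.num_div_denom f, map_div₀, map_div₀, key, key]

theorem lin_ne (u v : ℂ) (h : u ≠ 0) : Cc u - Cc v * Xv ^ 2 ≠ 0 := by
  have : Cc u - Cc v * Xv ^ 2 = algebraMap (Polynomial ℂ) (RatFunc ℂ)
      (Polynomial.C u - Polynomial.C v * Polynomial.X ^ 2) := by
    simp [Cc, Xv]
  rw [this]
  intro h0
  rw [map_eq_zero_iff _ (RatFunc.algebraMap_injective ℂ)] at h0
  have := congrArg (Polynomial.eval 0) h0
  simp at this
  exact h this

theorem stmt11 (q a b c d : ℂ) (hq : q ≠ 0) (hroot : ∀ m : ℕ, 1 ≤ m → q ^ m ≠ 1)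
    (ha : a ≠ 0) (hb : b ≠ 0) (hc : c ≠ 0) (hd : d ≠ 0) :
    ∀ f : RatFunc ℂ, IsLaurent f → subst Xv⁻¹ f = f →
      Cc (q + q⁻¹) * DsymOp q a b c d ((Xv + Xv⁻¹) * DsymOp q a b c d f)
        - DsymOp q a b c d (DsymOp q a b c d ((Xv + Xv⁻¹) * f))
        - (Xv + Xv⁻¹) * DsymOp q a b c d (DsymOp q a b c d f)
      = Cc ((1 - q⁻¹) ^ 2 * (esym3 a b c d + q * esym1 a b c d)) * DsymOp q a b c d f
        + Cc (q⁻¹ * (q - q⁻¹) ^ 2 * esym4 a b c d) * ((Xv + Xv⁻¹) * f)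
        + Cc (-(q ^ (-3 : ℤ)) * (1 - q) ^ 2 * (1 + q) *
            (esym1 a b c d * esym4 a b c d + q * esym3 a b c d)) * f := by
  intro f _ _
  have hq' : q⁻¹ ≠ 0 := inv_ne_zero hq
  have Cinv : ∀ x : ℂ, Cc x⁻¹ = (Cc x)⁻¹ := fun x => map_inv₀ RatFunc.C x
  have C1 : Cc 1 = 1 := map_one RatFunc.C
  have Cpow : ∀ (x : ℂ) (n : ℕ), Cc (x ^ n) = Cc x ^ n := fun x n => map_pow RatFunc.C x n
  have Cmul : ∀ x y : ℂ, Cc (x * y) = Cc x * Cc y := fun x y => map_mul RatFunc.C x y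
  have Cadd : ∀ x y : ℂ, Cc (x + y) = Cc x + Cc y := fun x y => map_add RatFunc.C x y
  have Csub : ∀ x y : ℂ, Cc (x - y) = Cc x - Cc y := fun x y => map_sub RatFunc.C x y
  have Cneg : ∀ x : ℂ, Cc (-x) = -Cc x := fun x => map_neg RatFunc.C x
  have Q0 : Cc q ≠ 0 := by
    intro h; exact hq (RatFunc.C_injective (h.trans (map_zero RatFunc.C).symm))
  have z0 : Xv ≠ 0 := RatFunc.X_ne_zero
  have n1 : 1 - Xv ^ 2 ≠ 0 := by simpa [C1] using lin_ne 1 1 one_ne_zero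
  have n2 : 1 - Cc q * Xv ^ 2 ≠ 0 := by simpa [C1] using lin_ne 1 q one_ne_zero
  have n3 : Cc q - Xv ^ 2 ≠ 0 := by simpa [C1] using lin_ne q 1 hq
  have n4 : 1 - Cc q ^ 2 * Xv ^ 2 ≠ 0 := by
    have h := lin_ne 1 (q ^ 2) one_ne_zero
    rwa [C1, Cpow] at h
  have n5 : 1 - Cc q ^ 3 * Xv ^ 2 ≠ 0 := by
    have h := lin_ne 1 (q ^ 3) one_ne_zero
    rwa [C1, Cpow] at h
  have n6 : Cc q ^ 2 - Xv ^ 2 ≠ 0 := by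
    simpa [C1, Cpow] using lin_ne (q ^ 2) 1 (pow_ne_zero 2 hq)
  have n7 : Cc q ^ 3 - Xv ^ 2 ≠ 0 := by
    simpa [C1, Cpow] using lin_ne (q ^ 3) 1 (pow_ne_zero 3 hq)
  have hp := hplus (Cc q) (Cc a) (Cc b) (Cc c) (Cc d) Xv Q0 z0 n1 n2 n3 n4 n5
  have hm := hplus (Cc q) (Cc a) (Cc b) (Cc c) (Cc d) ((Cc q)⁻¹ * Xv) Q0
    (mul_ne_zero (inv_ne_zero Q0) z0)
    (by
      have : 1 - ((Cc q)⁻¹ * Xv) ^ 2 = (Cc q ^ 2 - Xv ^ 2) / Cc q ^ 2 := by field_simp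
      rw [this]; exact div_ne_zero n6 (pow_ne_zero 2 Q0))
    (by
      have : 1 - Cc q * ((Cc q)⁻¹ * Xv) ^ 2 = (Cc q - Xv ^ 2) / Cc q := by field_simp
      rw [this]; exact div_ne_zero n3 Q0)
    (by
      have : Cc q - ((Cc q)⁻¹ * Xv) ^ 2 = (Cc q ^ 3 - Xv ^ 2) / Cc q ^ 2 := by field_simp
      rw [this]; exact div_ne_zero n7 (pow_ne_zero 2 Q0))
    (by
      have : 1 - Cc q ^ 2 * ((Cc q)⁻¹ * Xv) ^ 2 = 1 - Xv ^ 2 := by field_simp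
      rw [this]; exact n1)
    (by
      have : 1 - Cc q ^ 3 * ((Cc q)⁻¹ * Xv) ^ 2 = 1 - Cc q * Xv ^ 2 := by field_simp
      rw [this]; exact n2)
  rw [mul_inv_cancel_left₀ Q0] at hm
  have h0 := hzero (Cc q) (Cc a) (Cc b) (Cc c) (Cc d) Xv Q0 z0 n1 n2 n3 n4 n6
  have sX := scaleHom_X q hq
  have tX : scaleHom q⁻¹ hq' Xv = (Cc q)⁻¹ * Xv := by rw [scaleHom_X, Cinv]
  have sC := scaleHom_C q hq
  have tC := scaleHom_C q⁻¹ hq'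
  have hpow : q ^ (-3 : ℤ) = q⁻¹ ^ 3 := by
    rw [zpow_neg, inv_pow]; norm_cast
  have key := hmain (scaleHom q hq) (scaleHom q⁻¹ hq')
    (scaleHom_comp _ _ _ _ (inv_mul_cancel₀ hq)) (scaleHom_comp _ _ _ _ (mul_inv_cancel₀ hq))
    (hA (Cc q) (Cc a) (Cc b) (Cc c) (Cc d) Xv) (hB (Cc q) (Cc a) (Cc b) (Cc c) (Cc d) Xv)
    (hx Xv) (1 + (Cc q)⁻¹ * Cc a * Cc b * Cc c * Cc d) (Cc q + (Cc q)⁻¹) _ _ _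
    (hA (Cc q) (Cc a) (Cc b) (Cc c) (Cc d) (Cc q * Xv))
    (hB (Cc q) (Cc a) (Cc b) (Cc c) (Cc d) (Cc q * Xv))
    (hA (Cc q) (Cc a) (Cc b) (Cc c) (Cc d) ((Cc q)⁻¹ * Xv))
    (hB (Cc q) (Cc a) (Cc b) (Cc c) (Cc d) ((Cc q)⁻¹ * Xv))
    (hx (Cc q * Xv)) (hx ((Cc q)⁻¹ * Xv))
    (hx (Cc q * (Cc q * Xv))) (hx ((Cc q)⁻¹ * ((Cc q)⁻¹ * Xv)))
    (by simp only [hA, hP, map_div₀, map_mul, map_sub, map_one, map_pow, sX, sC])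
    (by simp only [hB, hR, map_div₀, map_mul, map_sub, map_one, map_pow, sX, sC])
    (by simp only [hA, hP, map_div₀, map_mul, map_sub, map_one, map_pow, tX, tC])
    (by simp only [hB, hR, map_div₀, map_mul, map_sub, map_one, map_pow, tX, tC])
    (by simp only [hx, map_add, map_inv₀, sX])
    (by simp only [hx, map_add, map_inv₀, tX])
    (by simp only [hx, map_add, map_inv₀, map_mul, sX, sC])
    (by simp only [hx, map_add, map_inv₀, map_mul, tX, tC])
    (by simp only [map_add, map_one, map_mul, map_inv₀, sC])
    (by simp only [map_add, map_one, map_mul, map_inv₀, tC])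
    (by unfold hx; field_simp; ring) (by unfold hx; field_simp; ring)
    hp hm h0 (DsymOp q a b c d)
    (fun g => by
      unfold DsymOp
      rw [← Cinv, scaleHom_apply q hq, scaleHom_apply q⁻¹ hq']
      rfl) f
  simp only [hpow, Cinv, C1, Cpow, Cmul, Cadd, Csub, Cneg, esym1, esym3, esym4]
  exact key

end
end

section
/- The operator D := Y + q^{-1}abcd·Y^{-1}, where Y = T_1 T_0, commutes with T_1 and with T_0 on the space of Laurent polynomials. -/
open scoped BigOperators

noncomputable section

/-- The field of rational functions over ℂ, in which Laurent polynomials live. -/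
local notation "F" => RatFunc ℂ

theorem aux_trans (x : ℂ) (hx : x ≠ 0) : Transcendental ℂ (Cc x * Xv⁻¹) := by
  intro h
  have hX : Transcendental ℂ (RatFunc.X : RatFunc ℂ) := RatFunc.transcendental_X
  apply hX
  have hC : IsAlgebraic ℂ (Cc x) := by
    have := isAlgebraic_algebraMap (R := ℂ) (A := RatFunc ℂ) x
    rwa [RatFunc.algebraMap_eq_C] at this
  have hC0 : Cc x ≠ 0 := by simpa [Cc] using hx
  have h2 := hC.mul h.inv
  have : Cc x * (Cc x * Xv⁻¹)⁻¹ = RatFunc.X := by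
    rw [mul_inv, inv_inv, mul_inv_cancel_left₀ hC0]; rfl
  rwa [this] at h2

theorem aux_eval_ne {t : F} (ht : Transcendental ℂ t) (p : Polynomial ℂ) (hp : p ≠ 0) :
    Polynomial.eval₂ RatFunc.C t p ≠ 0 := by
  intro h
  apply ht
  refine ⟨p, hp, ?_⟩
  rw [Polynomial.aeval_def, RatFunc.algebraMap_eq_C]
  exact h

/-- Substitution at a transcendental point is a ring homomorphism. -/
def substHom (t : F) (ht : Transcendental ℂ t) : F →+* F where
  toFun := subst t
  map_one' := by simp [subst]
  map_zero' := by simp [subst]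
  map_add' x y := RatFunc.eval_add _ _ (aux_eval_ne ht _ (RatFunc.denom_ne_zero x))
    (aux_eval_ne ht _ (RatFunc.denom_ne_zero y))
  map_mul' x y := RatFunc.eval_mul _ _ (aux_eval_ne ht _ (RatFunc.denom_ne_zero x))
    (aux_eval_ne ht _ (RatFunc.denom_ne_zero y))

theorem exists_hom (x : ℂ) (hx : x ≠ 0) : ∃ σ : F →+* F,
    (∀ f, subst (Cc x * Xv⁻¹) f = σ f) ∧ (∀ c, σ (Cc c) = Cc c) ∧ σ Xv = Cc x * Xv⁻¹ ∧
    ∀ f, σ (σ f) = f := by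
  refine ⟨substHom _ (aux_trans x hx), fun f => rfl, ?_, ?_, ?_⟩
  · intro c
    exact RatFunc.eval_C _ _
  · exact RatFunc.eval_X _ _
  · have hc : ∀ c, substHom _ (aux_trans x hx) (Cc c) = Cc c := fun c => RatFunc.eval_C _ _
    have hX : substHom _ (aux_trans x hx) Xv = Cc x * Xv⁻¹ := RatFunc.eval_X _ _
    generalize substHom _ (aux_trans x hx) = σ at hc hX
    have hC0 : Cc x ≠ 0 := by simpa [Cc] using hx
    have key : (σ.comp σ) = RingHom.id F := by
      apply IsLocalization.ringHom_ext (nonZeroDivisors (Polynomial ℂ))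
      apply Polynomial.ringHom_ext
      · intro c
        have : algebraMap (Polynomial ℂ) F (Polynomial.C c) = Cc c := RatFunc.algebraMap_C c
        simp [hc, this]
      · have : algebraMap (Polynomial ℂ) F (Polynomial.X) = Xv := RatFunc.algebraMap_X
        simp only [RingHom.comp_apply, this, RingHom.id_apply, hX, map_mul, map_inv₀, hc]
        rw [mul_inv, inv_inv, mul_inv_cancel_left₀ hC0]
    intro f
    exact DFunLike.congr_fun key f

theorem Xv_ne : Xv ≠ 0 := RatFunc.X_ne_zero

theorem aux_sq (x : ℂ) : Cc x - Xv ^ 2 ≠ 0 := by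
  intro h
  have h1 : algebraMap (Polynomial ℂ) F (Polynomial.X ^ 2 - Polynomial.C x) = 0 := by
    rw [map_sub, map_pow, RatFunc.algebraMap_C, RatFunc.algebraMap_X]
    change Xv ^ 2 - Cc x = 0
    linear_combination -h
  rw [map_eq_zero_iff _ (RatFunc.algebraMap_injective ℂ)] at h1
  exact Polynomial.X_pow_sub_C_ne_zero (by norm_num) x h1

theorem Cc_one : Cc 1 = 1 := map_one RatFunc.C
theorem Cc_mul (x y : ℂ) : Cc (x * y) = Cc x * Cc y := map_mul RatFunc.C x y
theorem Cc_add (x y : ℂ) : Cc (x + y) = Cc x + Cc y := map_add RatFunc.C x y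
theorem Cc_inv (x : ℂ) : Cc x⁻¹ = (Cc x)⁻¹ := map_inv₀ RatFunc.C x
theorem Cc_ne {x : ℂ} (hx : x ≠ 0) : Cc x ≠ 0 := by simpa [Cc] using hx

theorem T1_props (a b : ℂ) :
    (∀ f g, T1op a b (f + g) = T1op a b f + T1op a b g) ∧
    (∀ x f, T1op a b (Cc x * f) = Cc x * T1op a b f) ∧
    (∀ f, T1op a b (T1op a b f) = -(1 + Cc a * Cc b) * T1op a b f - Cc a * Cc b * f) := by
  obtain ⟨σ, h1, h2, h3, h4⟩ := exists_hom 1 one_ne_zero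
  simp only [Cc_one, one_mul] at h1 h3
  simp only [T1op, h1]
  refine ⟨fun f g => by rw [map_add]; ring, fun x f => by rw [map_mul, h2]; ring, fun f => ?_⟩
  simp only [map_add, map_sub, map_mul, map_div₀, map_one, map_pow, h2, h3, h4]
  have hX := Xv_ne
  have hs : 1 - Xv ^ 2 ≠ 0 := by simpa [Cc_one] using aux_sq 1
  have hs' : 1 - Xv⁻¹ ^ 2 = -(1 - Xv ^ 2) / Xv ^ 2 := by field_simp; ring
  rw [hs']
  generalize σ f = g
  generalize Xv = X at *
  field_simp
  ring

theorem T0_props (q c d : ℂ) (hq : q ≠ 0) :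
    (∀ f g, T0op q c d (f + g) = T0op q c d f + T0op q c d g) ∧
    (∀ x f, T0op q c d (Cc x * f) = Cc x * T0op q c d f) ∧
    (∀ f, T0op q c d (T0op q c d f) =
      -(1 + (Cc q)⁻¹ * (Cc c * Cc d)) * T0op q c d f - (Cc q)⁻¹ * (Cc c * Cc d) * f) := by
  obtain ⟨σ, h1, h2, h3, h4⟩ := exists_hom q hq
  simp only [T0op, h1]
  refine ⟨fun f g => by rw [map_add]; ring, fun x f => by rw [map_mul, h2]; ring, fun f => ?_⟩
  simp only [map_add, map_sub, map_mul, map_div₀, map_pow, map_inv₀, h2, h3, h4]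
  have hX := Xv_ne
  have hQ := Cc_ne hq
  have hs := aux_sq q
  have hs' : Cc q - (Cc q * Xv⁻¹) ^ 2 = -(Cc q) * (Cc q - Xv ^ 2) / Xv ^ 2 := by
    field_simp; ring
  rw [hs']
  generalize σ f = g
  generalize Xv = X at *
  generalize Cc q = Q at *
  field_simp
  ring

theorem Dop_eq (q a b c d : ℂ) (hq : q ≠ 0)
    (ha : a ≠ 0) (hb : b ≠ 0) (hc : c ≠ 0) (hd : d ≠ 0) (f : F) :
    Dop q a b c d f = T1op a b (T0op q c d f) + T0op q c d (T1op a b f)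
      + Cc (1 + a * b) * T0op q c d f
      + Cc (1 + q⁻¹ * (c * d)) * T1op a b f
      + Cc ((1 + a * b) * (1 + q⁻¹ * (c * d))) * f := by
  obtain ⟨k1, k2, k3⟩ := T0_props q c d hq
  have e : T1inv a b f = Cc (-(a * b)⁻¹) * T1op a b f + Cc (-(1 + (a * b)⁻¹)) * f := by
    simp only [T1inv, Cc, map_neg, map_inv₀, map_mul, map_add, map_one]; ring
  simp only [Dop, Yop, Yinv, T0inv]
  rw [e, k1, k2, k2]
  have := Cc_ne hq
  have := Cc_ne ha
  have := Cc_ne hb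
  have := Cc_ne hc
  have := Cc_ne hd
  have hn : ∀ x, Cc (-x) = - Cc x := fun x => map_neg RatFunc.C x
  simp only [hn, Cc_inv, Cc_mul, Cc_add, Cc_one]
  field_simp
  ring

theorem stmt13 (q a b c d : ℂ) (hq : q ≠ 0) (hroot : ∀ m : ℕ, 1 ≤ m → q ^ m ≠ 1)
    (ha : a ≠ 0) (hb : b ≠ 0) (hc : c ≠ 0) (hd : d ≠ 0) :
    ∀ f : RatFunc ℂ, IsLaurent f →
      Dop q a b c d (T1op a b f) = T1op a b (Dop q a b c d f)
        ∧ Dop q a b c d (T0op q c d f) = T0op q c d (Dop q a b c d f) := by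
  intro f _
  obtain ⟨k1, k2, k3⟩ := T0_props q c d hq
  obtain ⟨l1, l2, l3⟩ := T1_props a b
  have hD := Dop_eq q a b c d hq ha hb hc hd
  have k3' : ∀ f, T0op q c d (T0op q c d f) =
      Cc (-(1 + q⁻¹ * (c * d))) * T0op q c d f + Cc (-(q⁻¹ * (c * d))) * f := by
    intro f
    rw [k3]
    simp only [Cc, map_neg, map_inv₀, map_mul, map_add, map_one]; ring
  have l3' : ∀ f, T1op a b (T1op a b f) =
      Cc (-(1 + a * b)) * T1op a b f + Cc (-(a * b)) * f := by
    intro f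
    rw [l3]
    simp only [Cc, map_neg, map_mul, map_add, map_one]; ring
  have hn : ∀ x, Cc (-x) = - Cc x := fun x => map_neg RatFunc.C x
  constructor
  · simp only [hD, l1, l2, l3', k1, k2]
    simp only [hn]
    ring
  · simp only [hD, l1, l2, k3', k1, k2]
    simp only [hn]
    ring

end
end
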